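/- arXiv:1103.0561 — 4 statements merged into one kernel-verified Lean document; each statement's English description precedes it below -/
import Mathlib

section
/- For every real path-loss exponent α > 2, every real s > 0, and every positive integer K, the integral over the plane ∫_{ℝ²} (1 − (1 + s·‖x‖^{−α})^{−K}) dx converges and equals s^{2/α} · 𝓘_K, where 𝓘_K = (2π/α) · Σ_{m=0}^{K−1} C(K,m) · B(m + 2/α, K − m − 2/α). -/
open Real MeasureTheory Set Filter

/-- The Beta function `B(a,b) = Γ(a)Γ(b)/Γ(a+b)`. -/
noncomputable def betaFn (a b : ℝ) : ℝ := Real.Gamma a * Real.Gamma b / Real.Gamma (a + b)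

/-- The interference constant
`𝓘_K = (2π/α) · Σ_{m=0}^{K−1} C(K,m) · B(m + 2/α, K − m − 2/α)`. -/
noncomputable def interfConst (α : ℝ) (K : ℕ) : ℝ :=
  (2 * Real.pi / α) *
    ∑ m ∈ Finset.range K, (K.choose m : ℝ) * betaFn ((m : ℝ) + 2 / α) ((K : ℝ) - m - 2 / α)

open ProbabilityTheory in
theorem beta_integrand_Ioo {a b : ℝ} (ha : 0 < a) (hb : 0 < b) :
    IntegrableOn (fun t : ℝ => t ^ (a - 1) * (1 - t) ^ (b - 1)) (Ioo 0 1) ∧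
    ∫ t in Ioo (0 : ℝ) 1, t ^ (a - 1) * (1 - t) ^ (b - 1) = betaFn a b := by
  have heq : EqOn (fun t : ℝ => (t : ℂ) ^ ((a : ℂ) - 1) * (1 - (t : ℂ)) ^ ((b : ℂ) - 1))
      (fun t : ℝ => ((t ^ (a - 1) * (1 - t) ^ (b - 1) : ℝ) : ℂ)) (Ioo 0 1) := by
    intro t ht
    have h : (0 : ℝ) ≤ 1 - t := by linarith [ht.2]
    simp only [Complex.ofReal_mul]
    rw [Complex.ofReal_cpow ht.1.le, Complex.ofReal_cpow h]
    push_cast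
    rfl
  have hc := Complex.betaIntegral_convergent (u := a) (v := b) (by simpa) (by simpa)
  rw [intervalIntegrable_iff_integrableOn_Ioo_of_le zero_le_one,
    integrableOn_congr_fun heq measurableSet_Ioo] at hc
  refine ⟨by simpa [IntegrableOn] using hc.re, ?_⟩
  have h := beta_eq_betaIntegralReal a b ha hb
  rw [Complex.betaIntegral, intervalIntegral.integral_of_le zero_le_one,
    integral_Ioc_eq_integral_Ioo, setIntegral_congr_fun measurableSet_Ioo heq,
    integral_complex_ofReal, Complex.ofReal_re] at h
  exact h.symm

theorem image_div_one_sub_Ioo : (fun t : ℝ => t / (1 - t)) '' Ioo 0 1 = Ioi 0 := by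
  ext u
  constructor
  · rintro ⟨t, ht, rfl⟩
    exact div_pos ht.1 (by linarith [ht.2])
  · intro (hu : 0 < u)
    refine ⟨u / (1 + u), ⟨by positivity, by rw [div_lt_one (by positivity)]; linarith⟩, ?_⟩
    have : 1 - u / (1 + u) = 1 / (1 + u) := by field_simp; ring
    simp only [this]
    field_simp

theorem beta_integrand_Ioi {a b : ℝ} (ha : 0 < a) (hb : 0 < b) :
    IntegrableOn (fun u : ℝ => u ^ (a - 1) * (1 + u) ^ (-(a + b))) (Ioi 0) ∧
    ∫ u in Ioi (0 : ℝ), u ^ (a - 1) * (1 + u) ^ (-(a + b)) = betaFn a b := by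
  have hd : ∀ t ∈ Ioo (0 : ℝ) 1,
      HasDerivWithinAt (fun t : ℝ => t / (1 - t)) (1 / (1 - t) ^ 2) (Ioo 0 1) t := by
    intro t ht
    have h : 1 - t ≠ 0 := by linarith [ht.2]
    have := (hasDerivAt_id t).div ((hasDerivAt_id t).const_sub 1) h
    refine (this.congr_deriv ?_).hasDerivWithinAt
    simp
  have hi : InjOn (fun t : ℝ => t / (1 - t)) (Ioo 0 1) := by
    intro x hx y hy hxy
    have h1 : 1 - x ≠ 0 := by linarith [hx.2]
    have h2 : 1 - y ≠ 0 := by linarith [hy.2]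
    simp only at hxy
    rw [div_eq_div_iff h1 h2] at hxy
    linarith
  have heq : EqOn (fun t : ℝ => |1 / (1 - t) ^ 2| •
        ((t / (1 - t)) ^ (a - 1) * (1 + t / (1 - t)) ^ (-(a + b))))
      (fun t : ℝ => t ^ (a - 1) * (1 - t) ^ (b - 1)) (Ioo 0 1) := by
    intro t ht
    have h : 0 < 1 - t := by linarith [ht.2]
    have h1 : 1 + t / (1 - t) = (1 - t)⁻¹ := by field_simp; ring
    simp only [smul_eq_mul]
    rw [h1, abs_of_pos (by positivity), div_rpow ht.1.le h.le, inv_rpow h.le, ← rpow_neg h.le,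
      neg_neg, div_eq_mul_inv (t ^ (a - 1)), ← rpow_neg h.le, one_div, ← rpow_natCast,
      ← rpow_neg h.le ((2 : ℕ) : ℝ)]
    have h2 : (1 - t) ^ (b - 1) =
        (1 - t) ^ (-((2 : ℕ) : ℝ)) * (1 - t) ^ (-(a - 1)) * (1 - t) ^ (a + b) := by
      rw [← rpow_add h, ← rpow_add h]
      congr 1
      push_cast
      ring
    rw [h2]
    ring
  rw [← image_div_one_sub_Ioo,
    integrableOn_image_iff_integrableOn_abs_deriv_smul measurableSet_Ioo hd hi,
    integral_image_eq_integral_abs_deriv_smul measurableSet_Ioo hd hi,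
    integrableOn_congr_fun heq measurableSet_Ioo, setIntegral_congr_fun measurableSet_Ioo heq]
  exact beta_integrand_Ioo ha hb

theorem one_sub_one_add_inv_rpow_neg {u : ℝ} (hu : 0 < u) (K : ℕ) :
    1 - (1 + u⁻¹) ^ (-(K : ℝ)) =
      ∑ m ∈ Finset.range K, (K.choose m : ℝ) * (u ^ m * (1 + u) ^ (-(K : ℝ))) := by
  have h : (1 + u⁻¹) = (1 + u) / u := by field_simp; ring
  have hb := add_pow u 1 K
  rw [Finset.sum_range_succ] at hb
  simp only [one_pow, mul_one, Nat.choose_self, Nat.cast_one] at hb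
  have hs : ∑ m ∈ Finset.range K, (K.choose m : ℝ) * (u ^ m * (1 + u) ^ (-(K : ℝ))) =
      (∑ m ∈ Finset.range K, u ^ m * (K.choose m : ℝ)) * (1 + u) ^ (-(K : ℝ)) := by
    rw [Finset.sum_mul]
    exact Finset.sum_congr rfl fun m _ => by ring
  rw [hs, eq_sub_of_add_eq hb.symm, h, rpow_neg (by positivity), rpow_neg (by positivity),
    rpow_natCast, rpow_natCast, div_pow, add_comm u 1]
  field_simp

theorem rpow_mul_one_sub_Ioi {p : ℝ} (hp0 : 0 < p) (hp1 : p < 1) (K : ℕ) :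
    IntegrableOn (fun u : ℝ => u ^ (p - 1) * (1 - (1 + u⁻¹) ^ (-(K : ℝ)))) (Ioi 0) ∧
    ∫ u in Ioi (0 : ℝ), u ^ (p - 1) * (1 - (1 + u⁻¹) ^ (-(K : ℝ))) =
      ∑ m ∈ Finset.range K, (K.choose m : ℝ) * betaFn (m + p) (K - m - p) := by
  have hB : ∀ m ∈ Finset.range K,
      IntegrableOn (fun u : ℝ => u ^ ((m : ℝ) + p - 1) * (1 + u) ^ (-(K : ℝ))) (Ioi 0) ∧
      ∫ u in Ioi (0 : ℝ), u ^ ((m : ℝ) + p - 1) * (1 + u) ^ (-(K : ℝ)) =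
        betaFn (m + p) (K - m - p) := by
    intro m hm
    have hm' : (m : ℝ) + 1 ≤ K := by exact_mod_cast Finset.mem_range.mp hm
    have h := beta_integrand_Ioi (a := m + p) (b := K - m - p) (by positivity) (by linarith)
    rwa [show (m : ℝ) + p + (K - m - p) = K by ring] at h
  have heq : EqOn (fun u : ℝ => u ^ (p - 1) * (1 - (1 + u⁻¹) ^ (-(K : ℝ))))
      (fun u : ℝ => ∑ m ∈ Finset.range K,
        (K.choose m : ℝ) * (u ^ ((m : ℝ) + p - 1) * (1 + u) ^ (-(K : ℝ)))) (Ioi 0) := by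
    intro u (hu : 0 < u)
    simp only
    rw [one_sub_one_add_inv_rpow_neg hu, Finset.mul_sum]
    refine Finset.sum_congr rfl fun m _ => ?_
    rw [add_sub_assoc, rpow_add hu, rpow_natCast]
    ring
  rw [integrableOn_congr_fun heq measurableSet_Ioi, setIntegral_congr_fun measurableSet_Ioi heq]
  refine ⟨integrable_finsetSum _ fun m hm => (hB m hm).1.const_mul _, ?_⟩
  rw [integral_finsetSum _ fun m hm => (hB m hm).1.const_mul _]
  refine Finset.sum_congr rfl fun m hm => ?_
  rw [integral_const_mul, (hB m hm).2]

theorem mul_one_sub_pathloss_Ioi {α s : ℝ} (hα : 2 < α) (hs : 0 < s) (K : ℕ) :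
    IntegrableOn (fun y : ℝ => y * (1 - (1 + s * y ^ (-α)) ^ (-(K : ℝ)))) (Ioi 0) ∧
    ∫ y in Ioi (0 : ℝ), y * (1 - (1 + s * y ^ (-α)) ^ (-(K : ℝ))) =
      s ^ (2 / α) / α *
        ∑ m ∈ Finset.range K, (K.choose m : ℝ) * betaFn (m + 2 / α) (K - m - 2 / α) := by
  have hα0 : 0 < α := by linarith
  have hs' : 0 < s⁻¹ := by positivity
  obtain ⟨hI, hv⟩ := rpow_mul_one_sub_Ioi (p := 2 / α) (by positivity)
    (by rw [div_lt_one hα0]; exact hα) K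
  set h : ℝ → ℝ := fun u => u ^ (2 / α - 1) * (1 - (1 + u⁻¹) ^ (-(K : ℝ))) with hh
  have heq : EqOn (fun y : ℝ => y * (1 - (1 + s * y ^ (-α)) ^ (-(K : ℝ))))
      (fun y : ℝ => (α * y ^ (α - 1)) • (s ^ (2 / α - 1) / α * h (s⁻¹ * y ^ α))) (Ioi 0) := by
    intro y (hy : 0 < y)
    have h1 : (s⁻¹ * y ^ α)⁻¹ = s * y ^ (-α) := by
      rw [mul_inv, inv_inv, rpow_neg hy.le]
    have h2 : (s⁻¹ * y ^ α) ^ (2 / α - 1) = (s ^ (2 / α - 1))⁻¹ * y ^ (2 - α) := by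
      rw [mul_rpow hs'.le (by positivity), inv_rpow hs.le, ← rpow_mul hy.le]
      congr 2
      field_simp
    have h3 : y ^ (α - 1) * y ^ (2 - α) = y := by
      rw [← rpow_add hy, show α - 1 + (2 - α) = 1 by ring, rpow_one]
    have h4 : s ^ (2 / α - 1) ≠ 0 := by positivity
    simp only [hh, smul_eq_mul, h1, h2]
    field_simp
    rw [mul_assoc, h3, mul_comm]
  have hI' : IntegrableOn (fun u => s ^ (2 / α - 1) / α * h (s⁻¹ * u)) (Ioi 0) := by
    refine Integrable.const_mul ?_ _
    exact (integrableOn_Ioi_comp_mul_left_iff h 0 hs').mpr (by simpa using hI)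
  rw [integrableOn_congr_fun heq measurableSet_Ioi, setIntegral_congr_fun measurableSet_Ioi heq]
  constructor
  · have := (integrableOn_Ioi_comp_rpow_iff (fun u => s ^ (2 / α - 1) / α * h (s⁻¹ * u))
      hα0.ne').mpr hI'
    rwa [abs_of_pos hα0] at this
  · rw [integral_comp_rpow_Ioi_of_pos (g := fun u => s ^ (2 / α - 1) / α * h (s⁻¹ * u)) hα0,
      integral_const_mul, integral_comp_mul_left_Ioi h 0 hs', mul_zero, hv, inv_inv,
      smul_eq_mul, rpow_sub_one hs.ne']
    field_simp

/-- For α > 2, s > 0 and K ≥ 1, the integral over the plane of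
`1 − (1 + s‖x‖^{−α})^{−K}` converges and equals `s^{2/α} · 𝓘_K`. -/
theorem stmt0 (α s : ℝ) (hα : 2 < α) (hs : 0 < s) (K : ℕ) (hK : 1 ≤ K) :
    Integrable (fun x : EuclideanSpace ℝ (Fin 2) =>
      1 - (1 + s * ‖x‖ ^ (-α)) ^ (-(K : ℝ))) ∧
    ∫ x : EuclideanSpace ℝ (Fin 2), (1 - (1 + s * ‖x‖ ^ (-α)) ^ (-(K : ℝ))) =
      s ^ (2 / α) * interfConst α K := by
  obtain ⟨hI, hv⟩ := mul_one_sub_pathloss_Ioi hα hs K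
  constructor
  · rw [integrable_fun_norm_addHaar volume
      (f := fun y : ℝ => 1 - (1 + s * y ^ (-α)) ^ (-(K : ℝ)))]
    simpa using hI
  · rw [integral_fun_norm_addHaar volume (fun y : ℝ => 1 - (1 + s * y ^ (-α)) ^ (-(K : ℝ)))]
    simp only [finrank_euclideanSpace, Fintype.card_fin, Nat.add_one_sub_one, pow_one, smul_eq_mul,
      hv, interfConst, Measure.real, EuclideanSpace.volume_ball_fin_two]
    rw [ENNReal.ofReal_one, one_pow, one_mul, ENNReal.toReal_ofReal pi_pos.le, nsmul_eq_mul]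
    push_cast
    ring
end

section
/- Fix a real α > 2 and for each positive integer K set 𝓘_K = (2π/α) · Σ_{m=0}^{K−1} C(K,m) · B(m + 2/α, K − m − 2/α). Then 𝓘_K / K^{2/α} converges as K → ∞ and lim_{K→∞} 𝓘_K / K^{2/α} = π · Γ(1 − 2/α). -/
open Real MeasureTheory Set Filter

/-- Gosper-type telescoping of the binomial-Gamma sum. -/
theorem sum_choose_mul_Gamma_mul_Gamma {s : ℝ} (hs : 0 < s) (hs1 : s < 1) (K : ℕ) (n : ℕ)
    (hn : n ≤ K) :
    K * s * ∑ m ∈ Finset.range n, (K.choose m : ℝ) * (Gamma (m + s) * Gamma (K - m - s)) =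
      n * K.choose n * Gamma (n + s) * Gamma (K - n - s + 1) := by
  induction n with
  | zero => simp
  | succ n ih =>
    have hK : (n : ℝ) + 1 ≤ K := by exact_mod_cast hn
    have hchoose : ((n : ℝ) + 1) * K.choose (n + 1) = K.choose n * (K - n) := by
      have h := Nat.choose_succ_right_eq K n
      rw [← Nat.cast_sub (by lia : n ≤ K), mul_comm]
      exact_mod_cast h
    have h1 : Gamma (((n + 1 : ℕ) : ℝ) + s) = (n + s) * Gamma (n + s) := by
      rw [← Gamma_add_one (by positivity)]
      push_cast
      ring_nf
    have h2 : Gamma ((K : ℝ) - n - s + 1) = (K - n - s) * Gamma (K - n - s) :=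
      Gamma_add_one (by linarith)
    have h3 : (K : ℝ) - (n + 1 : ℕ) - s + 1 = K - n - s := by push_cast; ring
    rw [Finset.sum_range_succ, mul_add, ih (by lia), h1, h2, h3]
    push_cast
    linear_combination -((n + s) * Gamma (n + s) * Gamma (K - n - s)) * hchoose

theorem Gamma_natCast_add_eq_prod {s : ℝ} (hs : 0 < s) (n : ℕ) :
    Gamma (n + s) = Gamma s * ∏ j ∈ Finset.range n, (s + j) := by
  induction n with
  | zero => simp
  | succ n ih =>
    have h : ((n + 1 : ℕ) : ℝ) + s = n + s + 1 := by push_cast; ring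
    rw [h, Gamma_add_one (by positivity), ih, Finset.prod_range_succ]
    ring

theorem tendsto_Gamma_natCast_add_div {s : ℝ} (hs : 0 < s) :
    Tendsto (fun n : ℕ => Gamma (n + s) / (Gamma n * (n : ℝ) ^ s)) atTop (nhds 1) := by
  have hfrac : Tendsto (fun n : ℕ => (n : ℝ) / (n + s)) atTop (nhds 1) :=
    tendsto_natCast_div_add_atTop s
  have hΓ : Gamma s ≠ 0 := (Gamma_pos_of_pos hs).ne'
  have h := hfrac.mul (tendsto_const_nhds (x := Gamma s) |>.div (GammaSeq_tendsto_Gamma s) hΓ)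
  rw [div_self hΓ, mul_one] at h
  refine h.congr' ?_
  filter_upwards [eventually_gt_atTop 0] with n hn
  have hn' : (0 : ℝ) < n := by exact_mod_cast hn
  have hfact : (n.factorial : ℝ) = n * Gamma n := by
    rw [← Gamma_nat_eq_factorial, Gamma_add_one hn'.ne']
  have hprod : ∏ j ∈ Finset.range n, (s + j) ≠ 0 :=
    Finset.prod_ne_zero_iff.mpr fun j _ => by positivity
  have hpow : (n : ℝ) ^ s ≠ 0 := (rpow_pos_of_pos hn' s).ne'
  have hΓn : Gamma n ≠ 0 := (Gamma_pos_of_pos hn').ne'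
  have hns : (n : ℝ) + s ≠ 0 := by positivity
  simp only [Pi.div_apply, GammaSeq]
  rw [Finset.prod_range_succ, hfact, Gamma_natCast_add_eq_prod hs, add_comm s n]
  field_simp

theorem interfConst_eq {α : ℝ} (hα : 2 < α) {K : ℕ} (hK : 0 < K) :
    interfConst α K = π * Gamma (1 - 2 / α) * (Gamma (K + 2 / α) / Gamma K) := by
  have hα0 : 0 < α := by linarith
  have hs : 0 < 2 / α := by positivity
  have hs1 : 2 / α < 1 := (div_lt_one hα0).mpr hα
  have hK' : (0 : ℝ) < K := by exact_mod_cast hK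
  have hsum := sum_choose_mul_Gamma_mul_Gamma hs hs1 K K le_rfl
  have hbeta (m : ℕ) : betaFn ((m : ℝ) + 2 / α) ((K : ℝ) - m - 2 / α) =
      Gamma (m + 2 / α) * Gamma (K - m - 2 / α) / Gamma K := by
    rw [betaFn]
    congr 2
    ring
  have hone : (K : ℝ) - K - 2 / α + 1 = 1 - 2 / α := by ring
  rw [hone, Nat.choose_self, Nat.cast_one, mul_one, mul_assoc, mul_assoc] at hsum
  have hsum' := mul_left_cancel₀ hK'.ne' hsum
  simp only [interfConst, hbeta, ← mul_div_assoc, ← Finset.sum_div]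
  rw [← mul_comm π 2, mul_div_assoc π 2 α]
  simp only [mul_div_assoc] at hsum' ⊢
  linear_combination (π / Gamma K) * hsum'

/-- For α > 2, `𝓘_K / K^{2/α} → π · Γ(1 − 2/α)` as K → ∞. -/
theorem stmt1 (α : ℝ) (hα : 2 < α) :
    Tendsto (fun K : ℕ => interfConst α K / (K : ℝ) ^ (2 / α)) atTop
      (nhds (Real.pi * Real.Gamma (1 - 2 / α))) := by
  have hα0 : 0 < α := by linarith
  have h := (tendsto_Gamma_natCast_add_div (s := 2 / α) (by positivity)).const_mul
    (π * Gamma (1 - 2 / α))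
  rw [mul_one] at h
  refine h.congr' ?_
  filter_upwards [eventually_gt_atTop 0] with K hK
  rw [interfConst_eq hα hK, mul_div_assoc, div_div]
end

section
/- Let α > 2, C₁ > 0, C₂ > 0, δ ∈ (0, 1], integer M ≥ 2, and let u₁, v₁, u₂, v₂ > 1 be reals with 1/u₁ + 1/v₁ = 1 and 1/u₂ + 1/v₂ = 1. Then ∫₀^∞ e^{−C₁x} e^{−C₂x^{2/α}} / ((1 + x)(1 + δx)^{M−1}) dx ≤ (u₁u₂C₁)^{−1/(u₁u₂)} · (Γ(1 + α/2))^{1/(u₁v₂)} · (u₁v₂C₂)^{−α/(2u₁v₂)} · ( ∫₀^∞ (1 + x)^{−v₁} (1 + δx)^{−(M−1)v₁} dx )^{1/v₁}. -/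
open Real MeasureTheory Set Filter

/-- Hölder's inequality for nonnegative functions on a measurable set, with the integrability
hypotheses stated on the powers of the functions. -/
theorem setIntegral_mul_le_of_integrableOn_rpow {X : Type*} [MeasurableSpace X] {μ : Measure X}
    {p q : ℝ} (hpq : p.HolderConjugate q) {s : Set X} (hs : MeasurableSet s) {f g : X → ℝ}
    (hf : AEStronglyMeasurable f (μ.restrict s)) (hg : AEStronglyMeasurable g (μ.restrict s))
    (hf0 : ∀ x ∈ s, 0 ≤ f x) (hg0 : ∀ x ∈ s, 0 ≤ g x)
    (hfp : IntegrableOn (fun x ↦ f x ^ p) s μ) (hgq : IntegrableOn (fun x ↦ g x ^ q) s μ) :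
    ∫ x in s, f x * g x ∂μ ≤
      (∫ x in s, f x ^ p ∂μ) ^ (1 / p) * (∫ x in s, g x ^ q ∂μ) ^ (1 / q) := by
  have memLp {r : ℝ} (hr : 0 < r) {h : X → ℝ} (hm : AEStronglyMeasurable h (μ.restrict s))
      (h0 : ∀ x ∈ s, 0 ≤ h x) (hi : IntegrableOn (fun x ↦ h x ^ r) s μ) :
      MemLp h (ENNReal.ofReal r) (μ.restrict s) := by
    refine (integrable_norm_rpow_iff hm (by simpa using hr) ENNReal.ofReal_ne_top).1 ?_
    refine hi.congr_fun (fun x hx ↦ ?_) hs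
    simp only [Real.norm_of_nonneg (h0 x hx), ENNReal.toReal_ofReal hr.le]
  exact integral_mul_le_Lp_mul_Lq_of_nonneg hpq (ae_restrict_of_forall_mem hs hf0)
    (ae_restrict_of_forall_mem hs hg0) (memLp hpq.pos hf hf0 hfp)
    (memLp hpq.symm.pos hg hg0 hgq)

theorem integrableOn_exp_neg_mul_rpow {b r : ℝ} (hb : 0 < b) (hr : 0 < r) :
    IntegrableOn (fun x : ℝ ↦ exp (-(b * x ^ r))) (Ioi 0) := by
  simpa using integrableOn_rpow_mul_exp_neg_mul_rpow (s := 0) (by norm_num) hr hb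

theorem integrableOn_exp_neg_mul {b : ℝ} (hb : 0 < b) :
    IntegrableOn (fun x : ℝ ↦ exp (-(b * x))) (Ioi 0) := by
  simpa using integrableOn_exp_neg_mul_rpow hb one_pos

theorem integrableOn_exp_neg_mul_mul_exp_neg_mul_rpow {c d : ℝ} (hc : 0 < c) (hd : 0 < d)
    (r : ℝ) :
    IntegrableOn (fun x : ℝ ↦ exp (-(c * x)) * exp (-(d * x ^ r))) (Ioi 0) := by
  refine (integrableOn_exp_neg_mul hc).mono' (by fun_prop) ?_
  refine ae_restrict_of_forall_mem measurableSet_Ioi fun x hx ↦ ?_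
  have : 0 ≤ d * x ^ r := mul_nonneg hd.le (rpow_nonneg (le_of_lt hx) r)
  rw [norm_of_nonneg (by positivity)]
  exact mul_le_of_le_one_right (exp_pos _).le (exp_le_one_iff.2 (by linarith))

theorem integral_exp_neg_mul_mul_exp_neg_mul_rpow_le {p q c d r : ℝ} (hpq : p.HolderConjugate q)
    (hc : 0 < c) (hd : 0 < d) (hr : 0 < r) :
    ∫ x in Ioi (0 : ℝ), exp (-(c * x)) * exp (-(d * x ^ r)) ≤
      (p * c) ^ (-(1 / p)) * (Gamma (1 + 1 / r) ^ (1 / q) * (q * d) ^ (-(1 / (r * q)))) := by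
  have hpc := mul_pos hpq.pos hc
  have hqd := mul_pos hpq.symm.pos hd
  have hfp (x : ℝ) : exp (-(c * x)) ^ p = exp (-(p * c * x)) := by
    rw [← exp_mul]; ring_nf
  have hgq (x : ℝ) : exp (-(d * x ^ r)) ^ q = exp (-(q * d * x ^ r)) := by
    rw [← exp_mul]; ring_nf
  have hf : ∫ x in Ioi (0 : ℝ), exp (-(p * c * x)) = (p * c)⁻¹ := by
    simpa [rpow_neg_one, one_add_one_eq_two] using integral_exp_neg_mul_rpow one_pos hpc
  have hg : ∫ x in Ioi (0 : ℝ), exp (-(q * d * x ^ r)) =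
      Gamma (1 + 1 / r) * (q * d) ^ (-(1 / r)) := by
    simpa [neg_div, add_comm, mul_comm] using integral_exp_neg_mul_rpow hr hqd
  have key := setIntegral_mul_le_of_integrableOn_rpow (μ := volume) hpq measurableSet_Ioi
    (f := fun x : ℝ ↦ exp (-(c * x))) (g := fun x ↦ exp (-(d * x ^ r)))
    (by fun_prop) (by fun_prop) (fun x _ ↦ (exp_pos _).le) (fun x _ ↦ (exp_pos _).le)
    (by simpa only [hfp] using integrableOn_exp_neg_mul hpc)
    (by simpa only [hgq] using integrableOn_exp_neg_mul_rpow hqd hr)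
  simp only [hfp, hgq, hf, hg] at key
  rwa [inv_rpow hpc.le, ← rpow_neg hpc.le,
    mul_rpow (Gamma_pos_of_pos (by positivity)).le (rpow_nonneg hqd.le _),
    ← rpow_mul hqd.le, neg_mul, one_div_mul_one_div] at key

theorem integrableOn_one_add_rpow_mul_one_add_mul_rpow {a b δ : ℝ} (ha : a < -1) (hb : b ≤ 0)
    (hδ : 0 ≤ δ) :
    IntegrableOn (fun x : ℝ ↦ (1 + x) ^ a * (1 + δ * x) ^ b) (Ioi 0) := by
  have hint : IntegrableOn (fun x : ℝ ↦ (1 + x) ^ a) (Ioi 0) := by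
    simpa only [add_comm] using integrableOn_add_rpow_Ioi_of_lt (m := 1) (c := 0) ha (by norm_num)
  refine hint.mono' (by fun_prop) ?_
  refine ae_restrict_of_forall_mem measurableSet_Ioi fun x (hx : 0 < x) ↦ ?_
  rw [norm_of_nonneg (by positivity)]
  exact mul_le_of_le_one_right (by positivity)
    (rpow_le_one_of_one_le_of_nonpos (by nlinarith) hb)

/-- Second Hölder bound on the average user rate: for conjugate pairs (u₁,v₁), (u₂,v₂),
`∫₀^∞ e^{−C₁x}e^{−C₂x^{2/α}}/((1+x)(1+δx)^{M−1}) dx ≤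
 (u₁u₂C₁)^{−1/(u₁u₂)}·(Γ(1+α/2))^{1/(u₁v₂)}·(u₁v₂C₂)^{−α/(2u₁v₂)}·
 (∫₀^∞ (1+x)^{−v₁}(1+δx)^{−(M−1)v₁} dx)^{1/v₁}`. -/
theorem stmt12 (α C₁ C₂ δ : ℝ) (M : ℕ) (u₁ v₁ u₂ v₂ : ℝ)
    (hα : 2 < α) (hC₁ : 0 < C₁) (hC₂ : 0 < C₂) (hδ0 : 0 < δ) (hδ1 : δ ≤ 1) (hM : 2 ≤ M)
    (hu₁ : 1 < u₁) (hv₁ : 1 < v₁) (hu₂ : 1 < u₂) (hv₂ : 1 < v₂)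
    (huv₁ : 1 / u₁ + 1 / v₁ = 1) (huv₂ : 1 / u₂ + 1 / v₂ = 1) :
    (∫ x in Set.Ioi (0 : ℝ),
        Real.exp (-(C₁ * x)) * Real.exp (-(C₂ * x ^ (2 / α))) /
          ((1 + x) * (1 + δ * x) ^ (M - 1))) ≤
      (u₁ * u₂ * C₁) ^ (-(1 / (u₁ * u₂))) * (Real.Gamma (1 + α / 2)) ^ (1 / (u₁ * v₂)) *
        (u₁ * v₂ * C₂) ^ (-(α / (2 * u₁ * v₂))) *
        (∫ x in Set.Ioi (0 : ℝ),
            (1 + x) ^ (-v₁) * (1 + δ * x) ^ (-((M - 1 : ℝ) * v₁))) ^ (1 / v₁) := by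
  have hc₁ : u₁.HolderConjugate v₁ :=
    Real.holderConjugate_iff.2 ⟨hu₁, by simpa only [one_div] using huv₁⟩
  have hc₂ : u₂.HolderConjugate v₂ :=
    Real.holderConjugate_iff.2 ⟨hu₂, by simpa only [one_div] using huv₂⟩
  have hα0 : 0 < α := by linarith
  have hM1 : (1 : ℝ) ≤ M := by exact_mod_cast (by omega : 1 ≤ M)
  have hβ : -((M - 1 : ℝ) * v₁) ≤ 0 := by nlinarith
  set f : ℝ → ℝ := fun x ↦ exp (-(C₁ * x)) * exp (-(C₂ * x ^ (2 / α)))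
  set g : ℝ → ℝ := fun x ↦ ((1 + x) * (1 + δ * x) ^ (M - 1))⁻¹
  have hfu (x : ℝ) : f x ^ u₁ =
      exp (-(u₁ * C₁ * x)) * exp (-(u₁ * C₂ * x ^ (2 / α))) := by
    rw [mul_rpow (exp_pos _).le (exp_pos _).le, ← exp_mul, ← exp_mul]; ring_nf
  have hgv : ∀ x ∈ Ioi (0 : ℝ),
      g x ^ v₁ = (1 + x) ^ (-v₁) * (1 + δ * x) ^ (-((M - 1 : ℝ) * v₁)) := by
    intro x (hx : 0 < x)
    have h1 : 0 ≤ 1 + x := by positivity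
    have h2 : 0 ≤ 1 + δ * x := by positivity
    rw [inv_rpow (by positivity), mul_rpow h1 (by positivity), mul_inv, rpow_neg h1, rpow_neg h2,
      ← rpow_natCast, ← rpow_mul h2, Nat.cast_sub (by omega), Nat.cast_one]
  have hint := integrableOn_exp_neg_mul_mul_exp_neg_mul_rpow
    (mul_pos hc₁.pos hC₁) (mul_pos hc₁.pos hC₂) (2 / α)
  have holder := setIntegral_mul_le_of_integrableOn_rpow (μ := volume) hc₁ measurableSet_Ioi
    (f := f) (g := g) (by fun_prop) (by fun_prop) (fun x _ ↦ by positivity)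
    (fun x (hx : 0 < x) ↦ by positivity) (by simpa only [hfu] using hint)
    ((integrableOn_one_add_rpow_mul_one_add_mul_rpow (by linarith) hβ hδ0.le).congr_fun
      (fun x hx ↦ (hgv x hx).symm) measurableSet_Ioi)
  rw [setIntegral_congr_fun measurableSet_Ioi hgv] at holder
  simp only [hfu] at holder
  refine holder.trans (mul_le_mul_of_nonneg_right ?_ (rpow_nonneg
    (setIntegral_nonneg measurableSet_Ioi fun x (hx : 0 < x) ↦ by positivity) _))
  have hu₂0 := hc₂.pos
  have hu₁0 := hc₁.pos
  have hv₂0 := hc₂.symm.pos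
  have inner := integral_exp_neg_mul_mul_exp_neg_mul_rpow_le hc₂ (mul_pos hu₁0 hC₁)
    (mul_pos hu₁0 hC₂) (div_pos two_pos hα0)
  have hΓ : 0 < Gamma (1 + 1 / (2 / α)) := Gamma_pos_of_pos (by positivity)
  refine (rpow_le_rpow (by positivity) inner (by positivity)).trans_eq ?_
  have hA : 0 < u₁ * u₂ * C₁ := by positivity
  have hB : 0 < u₁ * v₂ * C₂ := by positivity
  rw [mul_left_comm u₂, mul_left_comm v₂, ← mul_assoc u₁, ← mul_assoc u₁]
  generalize u₁ * u₂ * C₁ = A at hA ⊢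
  generalize u₁ * v₂ * C₂ = B at hB ⊢
  rw [mul_rpow (by positivity) (by positivity), mul_rpow (by positivity) (by positivity),
    ← rpow_mul hA.le, ← rpow_mul hΓ.le, ← rpow_mul hB.le, ← mul_assoc, one_div_div]
  congr 2
  · congr 1
    field_simp
  · congr 1
    field_simp
  · field_simp
end

section
/- Fix a real α > 2 and reals λ > 0, c > 0, β > 0, δ ∈ (0, 1], and for each positive integer K set 𝓘_K = (2π/α)·Σ_{m=0}^{K−1} C(K,m) B(m + 2/α, K − m − 2/α). Then the map K ↦ e^{−λ c 𝓘_K} · (1 + βδ)^{−(K−1)} is strictly decreasing in K: for every positive integer K, e^{−λ c 𝓘_{K+1}}(1 + βδ)^{−K} < e^{−λ c 𝓘_K}(1 + βδ)^{−(K−1)}. -/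
open Real MeasureTheory Set Filter

theorem betaFn_pos {a b : ℝ} (ha : 0 < a) (hb : 0 < b) : 0 < betaFn a b :=
  div_pos (mul_pos (Real.Gamma_pos_of_pos ha) (Real.Gamma_pos_of_pos hb))
    (Real.Gamma_pos_of_pos (add_pos ha hb))

theorem betaFn_eq_add_one_add {a b : ℝ} (ha : 0 < a) (hb : 0 < b) :
    betaFn a b = betaFn (a + 1) b + betaFn a (b + 1) := by
  have hab : a + b ≠ 0 := (add_pos ha hb).ne'
  have hΓ : Real.Gamma (a + b) ≠ 0 := (Real.Gamma_pos_of_pos (add_pos ha hb)).ne'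
  unfold betaFn
  rw [← add_assoc a b 1, add_right_comm a 1 b, Real.Gamma_add_one ha.ne',
    Real.Gamma_add_one hb.ne', Real.Gamma_add_one hab]
  field_simp

theorem sum_range_succ_choose_succ_mul (K : ℕ) (f : ℕ → ℝ) :
    ∑ m ∈ Finset.range (K + 1), ((K + 1).choose m : ℝ) * f m =
      ∑ m ∈ Finset.range K, (K.choose m : ℝ) * (f (m + 1) + f m) + f K := by
  have h := (Finset.sum_range_succ' (fun m => (K.choose m : ℝ) * f m) K).symm.trans
    (Finset.sum_range_succ (fun m => (K.choose m : ℝ) * f m) K)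
  rw [Finset.sum_range_succ']
  simp only [Nat.choose_succ_succ', Nat.cast_add, add_mul, mul_add, Finset.sum_add_distrib]
  simp only [Nat.choose_zero_right, Nat.choose_self, Nat.cast_one, one_mul] at h ⊢
  linarith

theorem interfConst_succ {α : ℝ} (hα : 2 < α) (K : ℕ) :
    interfConst α (K + 1) =
      interfConst α K + 2 * Real.pi / α * betaFn (K + 2 / α) (1 - 2 / α) := by
  have hd0 : 0 < 2 / α := by positivity
  have hd1 : 2 / α < 1 := (div_lt_one (by linarith)).2 hα
  unfold interfConst
  rw [sum_range_succ_choose_succ_mul K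
    (fun m => betaFn ((m : ℝ) + 2 / α) (((K + 1 : ℕ) : ℝ) - m - 2 / α)), ← mul_add]
  congr 2
  · refine Finset.sum_congr rfl fun m hm => ?_
    have hmK : (m : ℝ) + 1 ≤ K := by exact_mod_cast Finset.mem_range.1 hm
    rw [betaFn_eq_add_one_add (a := (m : ℝ) + 2 / α) (b := K - m - 2 / α)
      (by positivity) (by linarith)]
    push_cast
    ring_nf
  · push_cast
    ring_nf

theorem interfConst_lt_succ {α : ℝ} (hα : 2 < α) (K : ℕ) :
    interfConst α K < interfConst α (K + 1) := by
  have hd1 : 2 / α < 1 := (div_lt_one (by linarith)).2 hα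
  have hb : 0 < betaFn (K + 2 / α) (1 - 2 / α) := betaFn_pos (by positivity) (by linarith)
  rw [interfConst_succ hα]
  exact lt_add_of_pos_right _ (by positivity)

/-- The per-user throughput factor `K ↦ e^{−λc𝓘_K}(1 + βδ)^{−(K−1)}` is strictly
decreasing in the number of streams K. -/
theorem stmt19 (α lam c β δ : ℝ) (hα : 2 < α) (hlam : 0 < lam) (hc : 0 < c)
    (hβ : 0 < β) (hδ0 : 0 < δ) (hδ1 : δ ≤ 1) :
    ∀ K : ℕ, 1 ≤ K →
      Real.exp (-(lam * c * interfConst α (K + 1))) * (1 + β * δ) ^ (-(K : ℝ)) <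
        Real.exp (-(lam * c * interfConst α K)) * (1 + β * δ) ^ (-((K : ℝ) - 1)) := by
  intro K _
  have hI := mul_lt_mul_of_pos_left (interfConst_lt_succ hα K) (mul_pos hlam hc)
  have h1 : 1 < 1 + β * δ := lt_add_of_pos_right _ (mul_pos hβ hδ0)
  exact mul_lt_mul'' (Real.exp_lt_exp.2 (neg_lt_neg hI))
    (Real.rpow_lt_rpow_of_exponent_lt h1 (by linarith)) (by positivity) (by positivity)
end
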